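/- arXiv:math/0511434 — 2 statements merged into one kernel-verified Lean document; each statement's English description precedes it below -/
import Mathlib

section
/- Let q ≥ 2 and n ≥ 1 be integers. Define rational numbers h♯_0 = 0, h♯_j = q^{2j} − 1 for 1 ≤ j ≤ n−1, and h♯_j = −q^{2n−1} − 1 for n ≤ j ≤ 2n−1. For 1 ≤ i ≤ 2n−1 set γ♯_i = Σ_{j=1}^{i} (h♯_j − h♯_{j−1}) / ((q−1)·q^{j−1}). Then γ♯_i = (q+1)·(1 + q + ⋯ + q^{i−1}) for 1 ≤ i ≤ n−1, and γ♯_i = −(q+1)/(q−1) for n ≤ i ≤ 2n−1. -/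
/-- Corollary 3.2 (♯-components of the upper-numbering jumps), arithmetic form.
`h j` are the ♯-components of the lower-numbering jumps, `γ i` the partial Herbrand sums
with denominators `(q-1)·q^(j-1)` (the indices of the ramification subgroups). -/
theorem stmt_0 (q n : ℕ) (hq : 2 ≤ q) (hn : 1 ≤ n)
    (h γ : ℕ → ℚ)
    (hh0 : h 0 = 0)
    (hh1 : ∀ j : ℕ, 1 ≤ j → j ≤ n - 1 → h j = (q : ℚ) ^ (2 * j) - 1)
    (hh2 : ∀ j : ℕ, n ≤ j → j ≤ 2 * n - 1 → h j = -(q : ℚ) ^ (2 * n - 1) - 1)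
    (hγ : ∀ i : ℕ, 1 ≤ i → i ≤ 2 * n - 1 →
      γ i = ∑ j ∈ Finset.Icc 1 i, (h j - h (j - 1)) / (((q : ℚ) - 1) * (q : ℚ) ^ (j - 1))) :
    (∀ i : ℕ, 1 ≤ i → i ≤ n - 1 →
      γ i = ((q : ℚ) + 1) * ∑ j ∈ Finset.range i, (q : ℚ) ^ j) ∧
    (∀ i : ℕ, n ≤ i → i ≤ 2 * n - 1 → γ i = -((q : ℚ) + 1) / ((q : ℚ) - 1)) := by
  obtain ⟨m, rfl⟩ : ∃ m, n = m + 1 := ⟨n - 1, by omega⟩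
  have hq2 : (2 : ℚ) ≤ q := by exact_mod_cast hq
  have hq0 : (q : ℚ) ≠ 0 := by positivity
  have hq1 : (q : ℚ) - 1 ≠ 0 := by linarith
  have h_low (j : ℕ) (hj : j ≤ m) : h j = (q : ℚ) ^ (2 * j) - 1 := by
    rcases Nat.eq_zero_or_pos j with rfl | hpos
    · simp [hh0]
    · exact hh1 j hpos (by omega)
  have sum_low (i : ℕ) (hi : i ≤ m) :
      ∑ j ∈ Finset.Icc 1 i, (h j - h (j - 1)) / (((q : ℚ) - 1) * (q : ℚ) ^ (j - 1)) =
        ((q : ℚ) + 1) * ∑ j ∈ Finset.range i, (q : ℚ) ^ j := by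
    induction i with
    | zero => simp
    | succ k ih =>
      rw [Finset.sum_Icc_succ_top (by omega), ih (by omega), Finset.sum_range_succ, mul_add,
        Nat.add_sub_cancel, h_low (k + 1) hi, h_low k (by omega)]
      congr 1
      field_simp
      ring
  have sum_high (k : ℕ) (hk : k ≤ m) :
      ∑ j ∈ Finset.Icc 1 (m + 1 + k), (h j - h (j - 1)) / (((q : ℚ) - 1) * (q : ℚ) ^ (j - 1)) =
        -((q : ℚ) + 1) / ((q : ℚ) - 1) := by
    induction k with
    | zero =>
      rw [add_zero, Finset.sum_Icc_succ_top (by omega), sum_low m le_rfl, Nat.add_sub_cancel,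
        hh2 (m + 1) le_rfl (by omega), h_low m le_rfl, geom_sum_eq (sub_ne_zero.mp hq1),
        show 2 * (m + 1) - 1 = 2 * m + 1 by omega]
      field_simp
      ring
    | succ k ih =>
      rw [← add_assoc, Finset.sum_Icc_succ_top (by omega), ih (by omega), Nat.add_sub_cancel,
        hh2 (m + 1 + k + 1) (by omega) (by omega), hh2 (m + 1 + k) (by omega) (by omega)]
      simp
  refine ⟨fun i h1 hi => ?_, fun i h1 hi => ?_⟩
  · rw [hγ i h1 (by omega), sum_low i (by omega)]
  · obtain ⟨k, rfl⟩ := Nat.exists_eq_add_of_le h1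
    rw [hγ _ (by omega) hi, sum_high k (by omega)]
end

section
/- Let k be an algebraically closed field of characteristic p > 0 and let q be a power of p. Let K₀ = k((T)) be the field of formal Laurent series with its normalized T-adic valuation. Suppose given a tower of finite field extensions K₀ ⊆ L_1 ⊆ L_2 ⊆ ⋯ ⊆ L_n and elements z_m ∈ L_m such that z_1^{q−1} = −T and L_1 = K₀(z_1), and for each 1 ≤ m ≤ n−1, z_{m+1}^q + T^{q^m}·z_{m+1} = z_m and L_{m+1} = L_m(z_{m+1}). Then [L_n : K₀] = (q−1)·q^{n−1}, and for the unique valuation w on L_n extending the T-adic valuation of K₀, normalized so that w(L_n^×) = ℤ, one has w(z_n) = 1 (i.e. z_n is a uniformizer of L_n) and w(T) = (q−1)·q^{n−1} (i.e. L_n/K₀ is totally ramified). -/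
open Polynomial in
/-- In a tower `z (m + 1) ^ q + t ^ (q ^ m) * z (m + 1) = z m`, every lower element `z (n - j)` is
a monic polynomial of degree `q ^ j` in the top element `z n`, with zero constant term, which
reduces to `X ^ (q ^ j)` modulo `t`. -/
theorem exists_monic_eval₂_eq {R S : Type*} [CommRing R] [Nontrivial R] [CommRing S]
    (φ : R →+* S) (t : R) (q : ℕ) (hq : 2 ≤ q) (z : ℕ → S) (n : ℕ)
    (hz : ∀ m, 1 ≤ m → m ≤ n - 1 → z (m + 1) ^ q + φ t ^ (q ^ m) * z (m + 1) = z m)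
    (j : ℕ) (hj : j < n) :
    ∃ f : R[X], f.Monic ∧ f.natDegree = q ^ j ∧ f.coeff 0 = 0 ∧
      f.map (Ideal.Quotient.mk (Ideal.span {t})) = X ^ (q ^ j) ∧
      f.eval₂ φ (z n) = z (n - j) := by
  induction j with
  | zero => exact ⟨X, monic_X, by simp, by simp, by simp, by simp⟩
  | succ j ih =>
    obtain ⟨f, hf, hd, h0, hmap, hev⟩ := ih (by omega)
    obtain ⟨m, hm⟩ : ∃ m, n - j = m + 1 := ⟨n - j - 1, by omega⟩
    have hm' : n - (j + 1) = m := by omega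
    have hm1 : 1 ≤ m := by omega
    have hqj : 0 < q ^ j := by positivity
    have hlt : q ^ j < q ^ j * q := by nlinarith
    have hdpow : (f ^ q).natDegree = q ^ j * q := by rw [hf.natDegree_pow, hd, mul_comm]
    have hdeg : (C (t ^ (q ^ m)) * f).natDegree < (f ^ q).natDegree := by
      rw [hdpow]
      exact (natDegree_C_mul_le _ _).trans_lt (hd ▸ hlt)
    refine ⟨f ^ q + C (t ^ (q ^ m)) * f, ?_, ?_, ?_, ?_, ?_⟩
    · exact (hf.pow q).add_of_left (degree_lt_degree hdeg)
    · rw [natDegree_add_eq_left_of_natDegree_lt hdeg, hdpow, pow_succ]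
    · rw [coeff_zero_eq_eval_zero] at h0 ⊢
      simp [h0, show q ≠ 0 by omega]
    · have ht : Ideal.Quotient.mk (Ideal.span {t}) t = 0 :=
        Ideal.Quotient.eq_zero_iff_mem.mpr (Ideal.mem_span_singleton_self t)
      simp [Polynomial.map_pow, hmap, ht, show q ≠ 0 by omega, pow_succ, pow_mul]
    · rw [hm', eval₂_add, eval₂_pow, eval₂_mul, eval₂_C, hev, hm, map_pow]
      exact hz m hm1 (by omega)

open Polynomial in
/-- A positive power of a monic polynomial congruent to a power of `X` modulo a prime `t`, with zero
constant term, becomes irreducible over the fraction field after adding `t`. -/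
theorem irreducible_map_pow_add_C {R K : Type*} [CommRing R] [IsDomain R] [IsIntegrallyClosed R]
    [Field K] [Algebra R K] [IsFractionRing R K] {t : R} (ht : Prime t) {f : R[X]} (hf : f.Monic)
    {d e : ℕ} (hd : f.natDegree = d) (hd0 : 0 < d) (he : 0 < e) (h0 : f.coeff 0 = 0)
    (hmap : f.map (Ideal.Quotient.mk (Ideal.span {t})) = X ^ d) :
    (f ^ e + C t).Monic ∧ (f ^ e + C t).natDegree = e * d ∧
      Irreducible ((f ^ e + C t).map (algebraMap R K)) := by
  have hpos : 0 < e * d := by positivity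
  have hdpow : (f ^ e).natDegree = e * d := by rw [hf.natDegree_pow, hd]
  have hdeg : (C t).natDegree < (f ^ e).natDegree := by rw [natDegree_C, hdpow]; exact hpos
  have hmon : (f ^ e + C t).Monic := (hf.pow e).add_of_left (degree_lt_degree hdeg)
  have hnat : (f ^ e + C t).natDegree = e * d := by
    rw [natDegree_add_eq_left_of_natDegree_lt hdeg, hdpow]
  have hprime : (Ideal.span {t}).IsPrime := (Ideal.span_singleton_prime ht.ne_zero).mpr ht
  have hzero : Ideal.Quotient.mk (Ideal.span {t}) t = 0 :=
    Ideal.Quotient.eq_zero_iff_mem.mpr (Ideal.mem_span_singleton_self t)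
  refine ⟨hmon, hnat, (hmon.irreducible_iff_irreducible_map_fraction_map).mp ?_⟩
  refine IsEisensteinAt.irreducible (𝓟 := Ideal.span {t}) ⟨?_, ?_, ?_⟩ hprime hmon.isPrimitive
    (hnat ▸ hpos)
  · rw [hmon.leadingCoeff]
    exact fun h => hprime.ne_top ((Ideal.eq_top_iff_one _).mpr h)
  · intro i hi
    rw [hnat] at hi
    rw [← Ideal.Quotient.eq_zero_iff_mem, ← coeff_map]
    simp [Polynomial.map_pow, hmap, hzero, ← pow_mul, coeff_X_pow, mul_comm d e, hi.ne]
  · have hc : (f ^ e + C t).coeff 0 = t := by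
      rw [coeff_zero_eq_eval_zero] at h0 ⊢
      simp [h0, he.ne']
    rw [hc, Ideal.span_singleton_pow, Ideal.mem_span_singleton]
    rintro ⟨c, hc⟩
    refine ht.not_isUnit (IsUnit.of_mul_eq_one c (mul_left_cancel₀ ht.ne_zero ?_))
    rw [mul_one, ← mul_assoc, ← pow_two, ← hc]

/-- If the coefficients have valuations in `b N ℤ` and `z` has valuation `b`, the valuation of a
sum `∑ i ∈ s, c i * z ^ i` with `s ⊆ {0, …, N - 1}` is congruent to `b i` modulo `b N` for some
`i ∈ s`, unless it is infinite. -/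
theorem AddValuation.sum_mul_pow_eq {L : Type*} [Field L] (v : AddValuation L (WithTop ℤ)) {z : L}
    {b : ℤ} (hb : b ≠ 0) (hz : v z = b) {N : ℕ} (c : ℕ → L)
    (hc : ∀ i, v (c i) = ⊤ ∨ ∃ j : ℤ, v (c i) = ((b * (N * j) : ℤ) : WithTop ℤ))
    (s : Finset ℕ) (hs : ∀ i ∈ s, i < N) :
    v (∑ i ∈ s, c i * z ^ i) = ⊤ ∨
      ∃ i ∈ s, ∃ j : ℤ, v (∑ i ∈ s, c i * z ^ i) = ((b * (N * j + i) : ℤ) : WithTop ℤ) := by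
  classical
  induction s using Finset.induction_on with
  | empty => simp
  | insert a s ha ih =>
    rw [Finset.sum_insert ha]
    have hterm : v (c a * z ^ a) = ⊤ ∨
        ∃ j : ℤ, v (c a * z ^ a) = ((b * (N * j + a) : ℤ) : WithTop ℤ) := by
      rw [v.map_mul, v.map_pow, hz]
      rcases hc a with h | ⟨j, h⟩
      · left; simp [h]
      · right
        refine ⟨j, ?_⟩
        rw [h, ← WithTop.coe_nsmul, ← WithTop.coe_add]
        congr 1
        rw [nsmul_eq_mul]; ring
    rcases hterm with h | ⟨j, h⟩
    · rw [v.top_iff] at h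
      rw [h, zero_add]
      refine (ih fun i hi => hs i (Finset.mem_insert_of_mem hi)).imp_right ?_
      rintro ⟨i, hi, j, hj⟩
      exact ⟨i, Finset.mem_insert_of_mem hi, j, hj⟩
    · rcases ih fun i hi => hs i (Finset.mem_insert_of_mem hi) with h' | ⟨i, hi, j', h'⟩
      · rw [v.top_iff] at h'
        rw [h', add_zero]
        exact Or.inr ⟨a, Finset.mem_insert_self _ _, j, h⟩
      · right
        have hne : b * (N * j + a) ≠ b * (N * j' + i) := by
          intro heq
          have h1 := mul_left_cancel₀ hb heq
          have haN := hs a (Finset.mem_insert_self _ _)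
          have hiN := hs i (Finset.mem_insert_of_mem hi)
          have h2 : (a : ℤ) = i := by
            have h3 := congrArg (· % (N : ℤ)) h1
            simp only [Int.mul_add_emod_self_left] at h3
            rwa [Int.emod_eq_of_lt (by omega) (by omega),
              Int.emod_eq_of_lt (by omega) (by omega)] at h3
          exact ha (Nat.cast_injective h2 ▸ hi)
        rcases lt_or_gt_of_ne hne with hlt | hlt
        · refine ⟨a, Finset.mem_insert_self _ _, j, ?_⟩
          rw [v.map_add_eq_of_lt_left (by rw [h, h']; exact_mod_cast hlt), h]
        · refine ⟨i, Finset.mem_insert_of_mem hi, j', ?_⟩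
          rw [v.map_add_eq_of_lt_right (by rw [h, h']; exact_mod_cast hlt), h']

/-- A valuation on `L` compatible with the order on `k((T))` is `v T` times the order there. -/
theorem AddValuation.map_algebraMap_laurentSeries {k L : Type*} [Field k] [Field L]
    [Algebra (LaurentSeries k) L] (v : AddValuation L (WithTop ℤ))
    (hv : ∀ f g : LaurentSeries k, f ≠ 0 → g ≠ 0 →
      (v (algebraMap (LaurentSeries k) L f) ≤ v (algebraMap (LaurentSeries k) L g) ↔
        f.order ≤ g.order)) :
    ∃ a : ℤ, 0 < a ∧
      ∀ f : LaurentSeries k, f ≠ 0 → v (algebraMap (LaurentSeries k) L f) =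
        ((a * f.order : ℤ) : WithTop ℤ) := by
  have hne (f : LaurentSeries k) (hf : f ≠ 0) : v (algebraMap _ L f) ≠ ⊤ := by
    rw [v.ne_top_iff]
    exact (_root_.map_ne_zero _).mpr hf
  have heq (f g : LaurentSeries k) (hf : f ≠ 0) (hg : g ≠ 0) (h : f.order = g.order) :
      v (algebraMap _ L f) = v (algebraMap _ L g) :=
    le_antisymm ((hv f g hf hg).mpr h.le) ((hv g f hg hf).mpr h.ge)
  set T : LaurentSeries k := HahnSeries.single (1 : ℤ) (1 : k) with hT
  have hT0 : T ≠ 0 := HahnSeries.single_ne_zero one_ne_zero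
  have hTo : T.order = 1 := HahnSeries.order_single one_ne_zero
  obtain ⟨a, ha⟩ := WithTop.ne_top_iff_exists.mp (hne T hT0)
  have hpow (m : ℕ) : v (algebraMap _ L (T ^ m)) = ((a * m : ℤ) : WithTop ℤ) := by
    rw [_root_.map_pow, v.map_pow, ← ha, ← WithTop.coe_nsmul, nsmul_eq_mul, mul_comm]
  have hopow (m : ℕ) : (T ^ m).order = m := by
    rw [HahnSeries.order_pow, hTo]; simp
  refine ⟨a, ?_, fun f hf => ?_⟩
  · by_contra hle
    have h : v (algebraMap _ L T) ≤ v (algebraMap _ L (1 : LaurentSeries k)) := by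
      rw [_root_.map_one, v.map_one, ← ha]
      exact_mod_cast not_lt.mp hle
    have := (hv T 1 hT0 one_ne_zero).mp h
    rw [hTo, HahnSeries.order_one] at this
    omega
  · rcases Int.eq_nat_or_neg f.order with ⟨m, hm | hm⟩
    · rw [heq f (T ^ m) hf (pow_ne_zero _ hT0) (by rw [hopow, hm]), hpow, hm]
    · have h0 := heq (f * T ^ m) 1 (mul_ne_zero hf (pow_ne_zero _ hT0)) one_ne_zero (by
        rw [HahnSeries.order_mul hf (pow_ne_zero _ hT0), hopow, hm, HahnSeries.order_one]; simp)
      rw [_root_.map_mul, v.map_mul, hpow, _root_.map_one, v.map_one] at h0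
      obtain ⟨y, hy⟩ := WithTop.ne_top_iff_exists.mp (hne f hf)
      rw [← hy, ← WithTop.coe_add] at h0
      rw [← hy, hm]
      have h1 : y + a * m = 0 := by exact_mod_cast h0
      congr 1
      linarith

/-- In a tower `z (m + 1) ^ q + t ^ (q ^ m) * z (m + 1) = z m` starting at `z 1 ^ (q - 1) = -t` with
`t` of positive valuation, the valuation is divided by `q` at every step. -/
theorem AddValuation.tower_eq {L : Type*} [Field L] (v : AddValuation L (WithTop ℤ)) {t : L} {a : ℤ}
    (ha : 0 < a) (ht : v t = a) {q n : ℕ} (hq : 2 ≤ q) {z : ℕ → L} (hz1 : z 1 ^ (q - 1) = -t)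
    (hz : ∀ m, 1 ≤ m → m ≤ n - 1 → z (m + 1) ^ q + t ^ (q ^ m) * z (m + 1) = z m)
    (m : ℕ) (hm : m + 1 ≤ n) :
    ∃ b : ℤ, 0 < b ∧ v (z (m + 1)) = b ∧ a = (((q - 1) * q ^ m : ℕ) : ℤ) * b := by
  induction m with
  | zero =>
    have h := congrArg v hz1
    rw [v.map_pow, v.map_neg, ht] at h
    have hne : v (z 1) ≠ ⊤ := by
      intro htop
      rw [v.top_iff] at htop
      rw [htop, v.map_zero] at h
      obtain ⟨r, hr⟩ : ∃ r, q - 1 = r + 1 := ⟨q - 2, by omega⟩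
      rw [hr, succ_nsmul] at h
      simp at h
    obtain ⟨b, hb⟩ := WithTop.ne_top_iff_exists.mp hne
    rw [← hb, ← WithTop.coe_nsmul, WithTop.coe_inj, nsmul_eq_mul] at h
    refine ⟨b, ?_, hb.symm, by rw [← h]; simp⟩
    have : 0 ≤ ((q - 1 : ℕ) : ℤ) := by positivity
    nlinarith
  | succ m ih =>
    obtain ⟨c, hc, hvc, hac⟩ := ih (by omega)
    have h := hz (m + 1) (by omega) (by omega)
    set y := z (m + 1 + 1)
    have hy : v y ≠ ⊤ := by
      intro htop
      rw [v.top_iff] at htop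
      rw [htop, zero_pow (by omega), mul_zero, zero_add] at h
      rw [← h, v.map_zero] at hvc
      exact WithTop.top_ne_coe hvc
    obtain ⟨b, hb⟩ := WithTop.ne_top_iff_exists.mp hy
    have h1 : v (y ^ q) = ((q * b : ℤ) : WithTop ℤ) := by
      rw [v.map_pow, ← hb, ← WithTop.coe_nsmul, nsmul_eq_mul]
    have h2 : v (t ^ q ^ (m + 1) * y) = (((q : ℤ) ^ (m + 1) * a + b : ℤ) : WithTop ℤ) := by
      rw [v.map_mul, v.map_pow, ht, ← hb, ← WithTop.coe_nsmul, nsmul_eq_mul, ← WithTop.coe_add]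
      push_cast
      rfl
    have hQ : (2 : ℤ) ≤ (q : ℤ) ^ (m + 1) := by
      exact_mod_cast hq.trans (Nat.le_self_pow (by omega) q)
    have hca : c ≤ a := by
      have : 0 < (q - 1) * q ^ m := Nat.mul_pos (by omega) (by positivity)
      have : (1 : ℤ) ≤ (((q - 1) * q ^ m : ℕ) : ℤ) := by exact_mod_cast this
      nlinarith
    have hq' : (2 : ℤ) ≤ q := by exact_mod_cast hq
    rcases lt_or_ge ((q : ℤ) * b) ((q : ℤ) ^ (m + 1) * a + b) with hlt | hge
    · have h3 : v (y ^ q + t ^ q ^ (m + 1) * y) = v (y ^ q) :=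
        v.map_add_eq_of_lt_left (by rw [h1, h2]; exact_mod_cast hlt)
      rw [h, hvc, h1, WithTop.coe_inj] at h3
      refine ⟨b, by nlinarith, hb.symm, ?_⟩
      rw [hac, h3]
      push_cast
      ring
    · exfalso
      have hbpos : 0 < b := by nlinarith
      have h3 : (((q : ℤ) ^ (m + 1) * a + b : ℤ) : WithTop ℤ) ≤
          v (y ^ q + t ^ q ^ (m + 1) * y) :=
        v.map_le_add (by rw [h1]; exact_mod_cast hge) h2.ge
      rw [h, hvc, WithTop.coe_le_coe] at h3
      nlinarith


/-- Lemma 3.5 of the paper: the tower of residue field extensions of `K₀ = k((T))`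
generated by `z 1` with `z 1 ^ (q-1) = −T` and `z (m+1)` with
`z (m+1) ^ q + T^(q^m) · z (m+1) = z m` is totally ramified of degree `(q−1)·q^(n−1)`,
and `z n` is a uniformizer for the (unique) normalized extension `w` of the `T`-adic
valuation. Here `T = HahnSeries.single 1 1` and the `T`-adic valuation of a nonzero
Laurent series is its order. -/
theorem stmt_7 (k : Type) [Field k] [IsAlgClosed k]
    (p : ℕ) (hp : p.Prime) [CharP k p]
    (q : ℕ) (hq : ∃ s : ℕ, 0 < s ∧ q = p ^ s)
    (n : ℕ) (hn : 1 ≤ n)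
    (L : Type) [Field L] [Algebra (LaurentSeries k) L]
    (z : ℕ → L)
    (hz1 : z 1 ^ (q - 1)
      = - algebraMap (LaurentSeries k) L (HahnSeries.single (1 : ℤ) (1 : k)))
    (hzrec : ∀ m : ℕ, 1 ≤ m → m ≤ n - 1 →
      z (m + 1) ^ q
        + (algebraMap (LaurentSeries k) L (HahnSeries.single (1 : ℤ) (1 : k))) ^ (q ^ m)
          * z (m + 1) = z m)
    (hgen : IntermediateField.adjoin (LaurentSeries k)
      {x : L | ∃ m : ℕ, 1 ≤ m ∧ m ≤ n ∧ x = z m} = ⊤) :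
    Module.finrank (LaurentSeries k) L = (q - 1) * q ^ (n - 1) ∧
    ∀ w : L → WithTop ℤ,
      (∀ x, w x = ⊤ ↔ x = 0) →
      (∀ x y, w (x * y) = w x + w y) →
      (∀ x y, min (w x) (w y) ≤ w (x + y)) →
      -- normalization: the value group of `w` on `Lˣ` is all of `ℤ`
      (∀ m : ℤ, ∃ x : L, w x = (m : WithTop ℤ)) →
      -- `w` extends (up to normalization) the `T`-adic valuation of `k((T))`
      (∀ f g : LaurentSeries k, f ≠ 0 → g ≠ 0 →
        (w (algebraMap (LaurentSeries k) L f) ≤ w (algebraMap (LaurentSeries k) L g) ↔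
          f.order ≤ g.order)) →
      w (z n) = ((1 : ℤ) : WithTop ℤ) ∧
      w (algebraMap (LaurentSeries k) L (HahnSeries.single (1 : ℤ) (1 : k)))
        = ((((q : ℤ) - 1) * (q : ℤ) ^ (n - 1) : ℤ) : WithTop ℤ) := by
  have hq2 : 2 ≤ q := by
    obtain ⟨s, hs, rfl⟩ := hq
    exact hp.two_le.trans (Nat.le_self_pow hs.ne' p)
  set T : LaurentSeries k := HahnSeries.single (1 : ℤ) (1 : k) with hT
  have hTX : algebraMap (PowerSeries k) (LaurentSeries k) PowerSeries.X = T := by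
    rw [LaurentSeries.coe_algebraMap, HahnSeries.ofPowerSeries_X]
  set φ : PowerSeries k →+* L :=
    (algebraMap (LaurentSeries k) L).comp (algebraMap (PowerSeries k) (LaurentSeries k)) with hφ
  have hφX : φ PowerSeries.X = algebraMap _ L T := by rw [hφ, RingHom.comp_apply, hTX]
  have hpoly := exists_monic_eval₂_eq φ PowerSeries.X q hq2 z n (by rw [hφX]; exact hzrec)
  obtain ⟨f, hf, hfd, hf0, hfmap, hfev⟩ := hpoly (n - 1) (by omega)
  obtain ⟨hmon, hdeg, hirr⟩ := irreducible_map_pow_add_C (K := LaurentSeries k)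
    PowerSeries.X_prime hf hfd (by positivity) (by omega : 0 < q - 1) hf0 hfmap
  set F := (f ^ (q - 1) + Polynomial.C PowerSeries.X).map
    (algebraMap (PowerSeries k) (LaurentSeries k)) with hF
  have hFmon : F.Monic := hmon.map _
  have hFdeg : F.natDegree = (q - 1) * q ^ (n - 1) := by rw [hF, hmon.natDegree_map, hdeg]
  have hFroot : Polynomial.aeval (z n) F = 0 := by
    rw [Polynomial.aeval_def, hF, Polynomial.eval₂_map, ← hφ, Polynomial.eval₂_add,
      Polynomial.eval₂_pow, Polynomial.eval₂_C, hfev, hφX, (by omega : n - (n - 1) = 1), hz1,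
      neg_add_cancel]
  have hint : IsIntegral (LaurentSeries k) (z n) := ⟨F, hFmon, hFroot⟩
  have htop : IntermediateField.adjoin (LaurentSeries k) {z n} = ⊤ := by
    rw [eq_top_iff, ← hgen, IntermediateField.adjoin_le_iff]
    rintro _ ⟨m, hm1, hmn, rfl⟩
    obtain ⟨g, -, -, -, -, hg⟩ := hpoly (n - m) (by omega)
    rw [Nat.sub_sub_self hmn, hφ, ← Polynomial.eval₂_map, ← Polynomial.aeval_def] at hg
    rw [← hg]
    exact IntermediateField.algebra_adjoin_le_adjoin _ _
      (Polynomial.aeval_mem_adjoin_singleton _ _)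
  refine ⟨?_, ?_⟩
  · rw [← IntermediateField.finrank_top', ← htop, IntermediateField.adjoin.finrank hint,
      ← minpoly.eq_of_irreducible_of_monic hirr hFroot hFmon, hFdeg]
  intro w hw0 hwmul hwadd hwsurj hwext
  have hw1 : w 1 = 0 := by
    obtain ⟨c, hc⟩ := WithTop.ne_top_iff_exists.mp (mt (hw0 1).mp one_ne_zero)
    have h := hwmul 1 1
    rw [mul_one, ← hc, ← WithTop.coe_add, WithTop.coe_inj] at h
    rw [← hc, (by omega : c = 0), WithTop.coe_zero]
  set v : AddValuation L (WithTop ℤ) :=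
    AddValuation.of w ((hw0 0).mpr rfl) hw1 hwadd hwmul with hv
  have hvw (x : L) : v x = w x := rfl
  obtain ⟨a, ha, hva⟩ := v.map_algebraMap_laurentSeries hwext
  have hvT : v (algebraMap _ L T) = a := by
    rw [hva T (HahnSeries.single_ne_zero one_ne_zero), HahnSeries.order_single one_ne_zero, mul_one]
  obtain ⟨b, hb, hvb, hab⟩ := v.tower_eq ha hvT hq2 hz1 hzrec (n - 1) (by omega)
  rw [Nat.sub_add_cancel hn] at hvb
  have hb1 : b = 1 := by
    obtain ⟨x, hx⟩ := hwsurj 1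
    have hxmem : x ∈ Algebra.adjoin (LaurentSeries k) {z n} := by
      rw [← IntermediateField.adjoin_simple_toSubalgebra_of_isAlgebraic hint.isAlgebraic, htop]
      trivial
    obtain ⟨P, rfl⟩ := Algebra.adjoin_mem_exists_aeval _ _ hxmem
    have hmod := Polynomial.aeval_modByMonic_eq_self_of_root (p := P) hFroot
    have hFne : F ≠ 1 := fun h => hirr.not_isUnit (h ▸ isUnit_one)
    have hlt := Polynomial.natDegree_modByMonic_lt P hFmon hFne
    rw [hFdeg] at hlt
    rw [← hmod, Polynomial.aeval_eq_sum_range' hlt, ← hvw] at hx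
    simp only [Algebra.smul_def] at hx
    have hcoeff (i : ℕ) : v (algebraMap _ L ((P %ₘ F).coeff i)) = ⊤ ∨
        ∃ j : ℤ, v (algebraMap _ L ((P %ₘ F).coeff i)) =
          ((b * (((q - 1) * q ^ (n - 1) : ℕ) * j) : ℤ) : WithTop ℤ) := by
      rcases eq_or_ne ((P %ₘ F).coeff i) 0 with h | h
      · left
        simp [h]
      · right
        refine ⟨((P %ₘ F).coeff i).order, ?_⟩
        rw [hva _ h, hab]
        congr 1
        ring
    rcases v.sum_mul_pow_eq hb.ne' hvb _ hcoeff
      (Finset.range ((q - 1) * q ^ (n - 1))) (fun i hi => Finset.mem_range.mp hi)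
      with h | ⟨i, -, j, h⟩
    · rw [hx] at h
      exact absurd h (WithTop.coe_ne_top)
    · rw [hx, WithTop.coe_inj] at h
      exact Int.eq_one_of_dvd_one hb.le ⟨_, h⟩
  refine ⟨by rw [← hvw, hvb, hb1], ?_⟩
  rw [← hvw, hvT, hab, hb1, mul_one]
  push_cast [Nat.cast_sub (by omega : 1 ≤ q)]
  rfl
end
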